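/- Let G be a finite group, N a nontrivial normal subgroup of G, and let χ ∈ Irr(G|N) with χ(1) = max(cd(G|N)). Then N ∩ ker χ is nilpotent. Moreover, if K/M is an abelian chief factor of G with M ⊆ N ∩ ker χ, then K is nilpotent. -/

import Mathlib

open CategoryTheory

/-- `cdOver G N` is `cd(G|N)`: the set of degrees `χ(1)` of irreducible complex characters
`χ` of `G` whose kernel does not contain `N`. -/
def cdOver (G : Type) [Group G] (N : Subgroup G) : Set ℕ :=
  { d | ∃ V : FDRep ℂ G, Simple V ∧ (¬ ∀ n ∈ N, V.character n = V.character 1) ∧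
        d = Module.finrank ℂ V }

theorem Complex.eq_one_of_mem_of_sum_eq_card {s : Multiset ℂ} (hs : ∀ z ∈ s, ‖z‖ = 1)
    (hsum : s.sum = s.card) : ∀ z ∈ s, z = 1 := by
  have key : ∀ t : Multiset ℂ, (∀ z ∈ t, ‖z‖ = 1) →
      t.sum.re ≤ t.card ∧ (t.sum.re = t.card → ∀ z ∈ t, z.re = 1) := by
    intro t
    induction t using Multiset.induction with
    | empty => simp
    | cons a t ih =>
      intro h
      obtain ⟨h1, h2⟩ := ih fun z hz => h z (Multiset.mem_cons_of_mem hz)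
      have ha : a.re ≤ 1 := (Complex.re_le_norm a).trans_eq (h a (Multiset.mem_cons_self a t))
      simp only [Multiset.sum_cons, Multiset.card_cons, Complex.add_re, Nat.cast_add, Nat.cast_one,
        Multiset.mem_cons, forall_eq_or_imp]
      exact ⟨by linarith, fun h => ⟨by linarith, h2 (by linarith)⟩⟩
  intro z hz
  have hre : z.re = 1 := (key s hs).2 (by simp [hsum]) z hz
  have hn := Complex.sq_norm z
  rw [hs z hz, Complex.normSq_apply, hre] at hn
  exact Complex.ext hre (by simpa using hn)

theorem LinearMap.eq_one_of_pow_eq_one_of_trace_eq_finrank {V : Type*} [AddCommGroup V]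
    [Module ℂ V] [FiniteDimensional ℂ V] {f : Module.End ℂ V} {m : ℕ} (hm : m ≠ 0)
    (hf : f ^ m = 1) (htr : LinearMap.trace ℂ V f = Module.finrank ℂ V) : f = 1 := by
  have hpow : ∀ μ : ℂ, f.HasEigenvalue μ → μ ^ m = 1 := by
    intro μ hμ
    obtain ⟨v, hv⟩ := hμ.exists_hasEigenvector
    have := hv.pow_apply m
    rw [hf, Module.End.one_apply] at this
    have h2 : (μ ^ m - 1) • v = 0 := by rw [sub_smul, ← this]; simp
    exact sub_eq_zero.mp ((smul_eq_zero.mp h2).resolve_right hv.2)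
  have hsplit : f.charpoly.Splits := IsAlgClosed.splits _
  rw [Module.End.trace_eq_sum_roots_charpoly_of_splits hsplit] at htr
  have hcard : f.charpoly.roots.card = Module.finrank ℂ V := by
    rw [← hsplit.natDegree_eq_card_roots, LinearMap.charpoly_natDegree]
  have hone : ∀ μ : ℂ, f.HasEigenvalue μ → μ = 1 := by
    intro μ hμ
    refine Complex.eq_one_of_mem_of_sum_eq_card (s := f.charpoly.roots) (fun z hz => ?_)
      (by rw [htr, hcard]) μ ?_
    · refine Complex.norm_eq_one_of_pow_eq_one (hpow z ?_) hm
      exact (Module.End.hasEigenvalue_iff_isRoot_charpoly f z).2 (Polynomial.isRoot_of_mem_roots hz)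
    · rw [Polynomial.mem_roots f.charpoly_monic.ne_zero]
      exact (Module.End.hasEigenvalue_iff_isRoot_charpoly f μ).1 hμ
  have hss : f.IsSemisimple := by
    refine Module.End.isSemisimple_of_squarefree_aeval_eq_zero
      (p := Polynomial.X ^ m - 1) ?_ (by simp [hf])
    exact (Polynomial.X_pow_sub_one_separable_iff.2 (by exact_mod_cast hm)).squarefree
  have htop : (⊤ : Submodule ℂ V) ≤ f.eigenspace 1 := by
    rw [← Module.End.iSup_maxGenEigenspace_eq_top f]
    refine iSup_le fun μ => ?_
    rw [hss.isFinitelySemisimple.maxGenEigenspace_eq_eigenspace]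
    by_cases h : f.HasEigenvalue μ
    · rw [hone μ h]
    · have : f.eigenspace μ = ⊥ := by_contra fun h' => h h'
      rw [this]; exact bot_le
  ext v
  simpa using Module.End.mem_eigenspace_iff.1 (htop (Submodule.mem_top (x := v)))

variable {G : Type} [Group G]

theorem FDRep.ρ_eq_one_of_character_eq [Finite G] (V : FDRep ℂ G) {g : G}
    (h : V.character g = V.character 1) : V.ρ g = 1 := by
  refine LinearMap.eq_one_of_pow_eq_one_of_trace_eq_finrank (m := Nat.card G) Nat.card_pos.ne' ?_ ?_
  · rw [← map_pow, pow_card_eq_one', map_one]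
  · rw [FDRep.char_one] at h; exact h

theorem FDRep.eq_bot_or_eq_top_of_simple (V : FDRep ℂ G) (hV : Simple V) (S : Submodule ℂ V)
    (hS : ∀ g, ∀ v ∈ S, V.ρ g v ∈ S) : S = ⊥ ∨ S = ⊤ := by
  let s : Subrepresentation V.ρ := ⟨S, fun g v hv => hS g v hv⟩
  let f : FDRep.of s.toRepresentation ⟶ V :=
    ⟨InducedCategory.homMk (ModuleCat.ofHom S.subtype), fun g => by ext1; rfl⟩
  have : Mono f := by
    refine ⟨fun a b hab => ?_⟩
    ext x
    exact ConcreteCategory.congr_hom hab x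
  by_cases hf : f = 0
  · left
    rw [eq_bot_iff]
    intro v hv
    exact ConcreteCategory.congr_hom hf (⟨v, hv⟩ : S)
  · right
    have : IsIso f := isIso_of_mono_of_nonzero hf
    rw [eq_top_iff]
    intro v _
    have h : f (inv f v) = v := ConcreteCategory.congr_hom (IsIso.inv_hom_id f) v
    rw [← h]
    exact Subtype.property (p := (· ∈ S)) (inv f v)

theorem FDRep.simple_of_isIrreducible [Finite G] {U : Type} [AddCommGroup U] [Module ℂ U]
    [FiniteDimensional ℂ U] (σ : Representation ℂ G U) [σ.IsIrreducible] : Simple (FDRep.of σ) := by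
  have := Fintype.ofFinite G
  have := invertibleOfNonzero (NeZero.ne (Nat.card G : ℂ))
  rw [FDRep.simple_iff_char_is_norm_one]
  have h := Representation.card_inv_mul_sum_char_mul_char_eq_finrank σ σ
  rw [Representation.IsIrreducible.finrank_intertwiningMap_self] at h
  have h0 : (Nat.card G : ℂ) ≠ 0 := NeZero.ne _
  field_simp at h
  exact h.trans (by rw [Nat.cast_one, mul_one])

namespace Representation

variable {V : Type} [AddCommGroup V] [Module ℂ V]

/-- The diagonal action of `G` on `V`-valued functions on `G ⧸ H`, which is a model of
`V ⊗ ℂ[G ⧸ H]`. -/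
def funCoset (ρ : Representation ℂ G V) (H : Subgroup G) : Representation ℂ G (G ⧸ H → V) where
  toFun g := LinearMap.pi fun ω => ρ g ∘ₗ LinearMap.proj (g⁻¹ • ω)
  map_one' := by ext; simp
  map_mul' g k := by
    apply LinearMap.ext
    intro f
    funext ω
    simp [mul_smul]

@[simp]
theorem funCoset_apply (ρ : Representation ℂ G V) (H : Subgroup G) (g : G) (f : G ⧸ H → V)
    (ω : G ⧸ H) : ρ.funCoset H g f ω = ρ g (f (g⁻¹ • ω)) := rfl

/-- Every irreducible representation of `G` whose restriction to `H` maps nontrivially to `ρ` has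
degree at most that of `ρ`. -/
def MaxDegreeOver (ρ : Representation ℂ G V) (H : Subgroup G) : Prop :=
  ∀ (U : Type) [AddCommGroup U] [Module ℂ U] [FiniteDimensional ℂ U] (σ : Representation ℂ G U),
    σ.IsIrreducible → ∀ f : U →ₗ[ℂ] V, f ≠ 0 → (∀ h ∈ H, ∀ u, f (σ h u) = ρ h (f u)) →
      Module.finrank ℂ U ≤ Module.finrank ℂ V

theorem isIrreducible_of_isAtom {ρ : Representation ℂ G V} {s : Subrepresentation ρ}
    (hs : IsAtom s) : s.toRepresentation.IsIrreducible := by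
  obtain ⟨hbot, hlt⟩ := hs
  have hne : ∃ v ∈ s, v ≠ 0 := by
    by_contra! h
    exact hbot (eq_bot_iff.2 fun v hv => h v hv)
  obtain ⟨v, hv, hv0⟩ := hne
  refine @IsSimpleOrder.mk _ _ _ ⟨⊥, ⊤, fun h => hv0 ?_⟩ fun t => ?_
  · have : (⟨v, hv⟩ : s.toSubmodule) ∈ (⊥ : Subrepresentation s.toRepresentation) :=
      
      h ▸ Submodule.mem_top (R := ℂ) (x := (⟨v, hv⟩ : s.toSubmodule))
    exact congrArg Subtype.val this
  · let t' : Subrepresentation ρ := ⟨t.toSubmodule.map s.toSubmodule.subtype, by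
      rintro g _ ⟨u, hu, rfl⟩
      exact ⟨_, t.apply_mem_toSubmodule g hu, rfl⟩⟩
    have hts : t' ≤ s := by
      rintro _ ⟨u, _, rfl⟩
      exact u.2
    rcases hts.lt_or_eq with h | h
    · left
      have h0 := hlt t' h
      refine eq_bot_iff.2 fun u hu => ?_
      have : (u : V) ∈ (⊥ : Subrepresentation ρ) := h0 ▸ ⟨u, hu, rfl⟩
      exact Subtype.ext this
    · right
      refine eq_top_iff.2 fun u _ => ?_
      obtain ⟨w, hw, hwu⟩ : (u : V) ∈ t' := h.ge u.2
      obtain rfl : w = u := Subtype.ext hwu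
      exact hw

theorem sum_smul_funCoset_eq_zero [Fintype G] [FiniteDimensional ℂ V]
    {ρ : Representation ℂ G V} {H : Subgroup G}
    (hirr : ∀ S : Submodule ℂ V, (∀ h ∈ H, ∀ v ∈ S, ρ h v ∈ S) → S = ⊥ ∨ S = ⊤)
    (hmax : ρ.MaxDegreeOver H) {a : G → ℂ} (ha : ∀ x ∉ H, a x = 0)
    (hsum : ∑ x, a x • ρ x = 0) : ∑ x, a x • ρ.funCoset H x = 0 := by
  set W := ρ.funCoset H
  set T : (G ⧸ H → V) →ₗ[ℂ] (G ⧸ H → V) := ∑ x, a x • W x with hT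
  have hsub : ∀ s : Subrepresentation W, s.toRepresentation.IsIrreducible →
      ∀ u ∈ s, T u = 0 := by
    intro s hs
    let f : s.toSubmodule →ₗ[ℂ] V := LinearMap.proj ((1 : G) : G ⧸ H) ∘ₗ s.toSubmodule.subtype
    have hf_apply : ∀ u : s.toSubmodule, f u = u.1 ((1 : G) : G ⧸ H) := fun _ => rfl
    have hequiv : ∀ h ∈ H, ∀ u, f (s.toRepresentation h u) = ρ h (f u) := by
      intro h hh u
      have h1 : h⁻¹ • ((1 : G) : G ⧸ H) = ((1 : G) : G ⧸ H) := by
        rw [← MulAction.mem_stabilizer_iff, MulAction.stabilizer_quotient]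
        exact H.inv_mem hh
      change ρ h (u.1 (h⁻¹ • ((1 : G) : G ⧸ H))) = _
      rw [h1, hf_apply]
    by_cases hf : f = 0
    · intro u hu
      have : u = 0 := by
        funext ω
        induction ω using QuotientGroup.induction_on with
        | H g =>
          have h2 := congrArg (ρ g) (LinearMap.congr_fun hf ⟨_, s.apply_mem_toSubmodule g⁻¹ hu⟩)
          change ρ g (ρ g⁻¹ (u (g⁻¹⁻¹ • ((1 : G) : G ⧸ H)))) = _ at h2
          rw [← Module.End.mul_apply, ← map_mul] at h2
          simpa using h2
      rw [this, map_zero]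
    · have hle := hmax _ s.toRepresentation hs f hf hequiv
      have hrange : f.range = ⊤ := by
        refine (hirr f.range ?_).resolve_left fun h => hf (LinearMap.range_eq_bot.1 h)
        rintro h hh _ ⟨u, rfl⟩
        exact ⟨_, hequiv h hh u⟩
      have hinj : f.ker = ⊥ := by
        have := f.finrank_range_add_finrank_ker
        rw [hrange, finrank_top] at this
        exact Submodule.finrank_eq_zero.1 (by omega)
      intro u hu
      set u' : s.toSubmodule := ⟨u, hu⟩
      have hT' : T u = ((∑ x, a x • s.toRepresentation x u' : s.toSubmodule) : G ⧸ H → V) := by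
        rw [hT]
        simp only [LinearMap.sum_apply, LinearMap.smul_apply, Submodule.coe_sum,
          Submodule.coe_smul]
        rfl
      have hz : (∑ x, a x • s.toRepresentation x u' : s.toSubmodule) = 0 := by
        rw [← Submodule.mem_bot ℂ, ← hinj, LinearMap.mem_ker, map_sum]
        have : (∑ x, a x • ρ x) (f u') = 0 := by rw [hsum]; rfl
        rw [← this, LinearMap.sum_apply]
        refine Finset.sum_congr rfl fun x _ => ?_
        by_cases hx : x ∈ H
        · rw [map_smul, hequiv x hx, LinearMap.smul_apply]
        · simp [ha x hx]
      rw [hT', hz]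
      rfl
  have hker : ∀ u ∈ sSup {m : Submodule (MonoidAlgebra ℂ G) W.asModule | 
      IsSimpleModule (MonoidAlgebra ℂ G) m},
      T u = 0 := by
    intro u hu
    rw [sSup_eq_iSup'] at hu
    induction hu using Submodule.iSup_induction' with
    | mem m x hx =>
      have hm : IsAtom m.1 := isSimpleModule_iff_isAtom.1 m.2
      exact hsub (Subrepresentation.ofSubmodule' m.1) (isIrreducible_of_isAtom
        ((OrderIso.isAtom_iff Subrepresentation.subrepresentationSubmoduleOrderIso.symm _).2 hm))
        x hx
    | zero => exact map_zero T
    | add x y _ _ hx hy => exact (map_add T x y).trans ((congrArg₂ (· + ·) hx hy).trans (add_zero _))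
  rw [IsSemisimpleModule.sSup_simples_eq_top] at hker
  exact LinearMap.ext fun u => hker u Submodule.mem_top

theorem sum_smul_stabilizer_eq_zero [Fintype G] [FiniteDimensional ℂ V]
    {ρ : Representation ℂ G V} {H : Subgroup G}
    (hirr : ∀ S : Submodule ℂ V, (∀ h ∈ H, ∀ v ∈ S, ρ h v ∈ S) → S = ⊥ ∨ S = ⊤)
    (hmax : ρ.MaxDegreeOver H) {a : G → ℂ} (ha : ∀ x ∉ H, a x = 0)
    (hsum : ∑ x, a x • ρ x = 0) (ω : G ⧸ H) [DecidablePred fun x : G => x • ω = ω] :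
    ∑ x, (if x • ω = ω then a x else 0) • ρ x = 0 := by
  classical
  ext v
  have h := congrFun (LinearMap.congr_fun (sum_smul_funCoset_eq_zero hirr hmax ha hsum)
    (Pi.single ω v)) ω
  rw [LinearMap.zero_apply, Pi.zero_apply] at h
  rw [LinearMap.zero_apply, ← h]
  simp only [LinearMap.sum_apply, Finset.sum_apply, LinearMap.smul_apply, Pi.smul_apply,
    funCoset_apply]
  refine Finset.sum_congr rfl fun x _ => ?_
  by_cases hx : x • ω = ω
  · have : x⁻¹ • ω = ω := by rw [inv_smul_eq_iff, hx]
    simp [hx, this]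
  · have : x⁻¹ • ω ≠ ω := fun h' => hx (by rw [inv_smul_eq_iff] at h'; exact h'.symm)
    simp [hx, Pi.single_eq_of_ne this]

theorem sum_smul_normalCore_eq_zero [Fintype G] [FiniteDimensional ℂ V]
    {ρ : Representation ℂ G V} {H : Subgroup G}
    (hirr : ∀ S : Submodule ℂ V, (∀ h ∈ H, ∀ v ∈ S, ρ h v ∈ S) → S = ⊥ ∨ S = ⊤)
    (hmax : ρ.MaxDegreeOver H) {a : G → ℂ} (ha : ∀ x ∉ H, a x = 0)
    (hsum : ∑ x, a x • ρ x = 0) [DecidablePred (· ∈ H.normalCore)] :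
    ∑ x, (if x ∈ H.normalCore then a x else 0) • ρ x = 0 := by
  classical
  have key : ∀ t : Finset (G ⧸ H), ∑ x, (if ∀ ω ∈ t, x • ω = ω then a x else 0) • ρ x = 0 := by
    intro t
    induction t using Finset.induction_on with
    | empty => simpa using hsum
    | insert ω t _ ih =>
      refine Eq.trans (Finset.sum_congr rfl fun x _ => ?_)
        (sum_smul_stabilizer_eq_zero hirr hmax (fun x hx => ?_) ih ω)
      · simp only [Finset.forall_mem_insert, ite_and]
      · simp [ha x hx]
  refine Eq.trans (Finset.sum_congr rfl fun x _ => ?_) (key Finset.univ)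
  congr 2
  rw [Subgroup.normalCore_eq_ker, MonoidHom.mem_ker, Equiv.Perm.ext_iff]
  simp

end Representation

namespace Sylow

variable {p : ℕ} {K : Subgroup G} (P : Sylow p K)

theorem mem_map_subtype_of_mem_normalizer {x : G} (hxK : x ∈ K)
    (hx : x ∈ Subgroup.normalizer ((P : Subgroup K).map K.subtype : Set G))
    (hxp : ∃ k, x ^ p ^ k = 1) : x ∈ (P : Subgroup K).map K.subtype := by
  let y : K := ⟨x, hxK⟩
  have hyp : IsPGroup p (Subgroup.zpowers y) := by
    obtain ⟨k, hk⟩ := hxp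
    rintro ⟨_, n, rfl⟩
    refine ⟨k, Subtype.ext (Subtype.ext ?_)⟩
    change (x ^ n) ^ p ^ k = 1
    rw [← zpow_natCast, zpow_comm, zpow_natCast, hk, one_zpow]
  have hy : y ∈ Subgroup.normalizer ((P : Subgroup K) : Set K) := by
    rw [Subgroup.mem_normalizer_iff] at hx ⊢
    intro k
    have hinj := K.subtype_injective
    exact (Subgroup.mem_map_iff_mem hinj).symm.trans
      ((hx k).trans (Subgroup.mem_map_iff_mem (x := y * k * y⁻¹) hinj))
  have h := (hyp.inf_normalizer_sylow P).le ⟨Subgroup.mem_zpowers y, hy⟩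
  exact ⟨y, h.2, rfl⟩

theorem exists_pow_eq_one_of_mem_map_subtype {x : G} (hx : x ∈ (P : Subgroup K).map K.subtype) :
    ∃ k, x ^ p ^ k = 1 := by
  obtain ⟨y, hy, rfl⟩ := hx
  obtain ⟨k, hk⟩ := P.2 ⟨y, hy⟩
  exact ⟨k, congrArg (fun z : P => ((z : K) : G)) hk⟩

theorem normal_map_subtype_inf_normalCore [K.Normal] :
    ((P : Subgroup K).map K.subtype ⊓
      (Subgroup.normalizer ((P : Subgroup K).map K.subtype : Set G)).normalCore).Normal := by
  refine ⟨fun x hx g => ?_⟩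
  have hcore := (Subgroup.normalCore_normal _).conj_mem x hx.2 g
  refine ⟨P.mem_map_subtype_of_mem_normalizer ?_ (Subgroup.normalCore_le _ hcore) ?_, hcore⟩
  · exact Subgroup.Normal.conj_mem inferInstance x (Subgroup.map_subtype_le _ hx.1) g
  · obtain ⟨k, hk⟩ := P.exists_pow_eq_one_of_mem_map_subtype hx.1
    exact ⟨k, by rw [conj_pow, hk, mul_one, mul_inv_cancel]⟩

theorem normal_map_subtype_inf_of_isNilpotent [Finite G] [Fact p.Prime] {M : Subgroup G} [M.Normal]
    [Group.IsNilpotent M] (hMK : M ≤ K) : ((P : Subgroup K).map K.subtype ⊓ M).Normal := by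
  let Q : Sylow p M := default
  have hQ : (Q : Subgroup M).Characteristic := Q.characteristic_of_normal inferInstance
  have hQ' : ((Q : Subgroup M).map M.subtype).Normal := inferInstance
  convert hQ' using 1
  apply le_antisymm
  · intro x hx
    have hpg : IsPGroup p (((P : Subgroup K).map K.subtype).subgroupOf M) := by
      rintro ⟨y, hy⟩
      obtain ⟨k, hk⟩ := P.exists_pow_eq_one_of_mem_map_subtype (Subgroup.mem_subgroupOf.1 hy)
      exact ⟨k, Subtype.ext (Subtype.ext hk)⟩
    obtain ⟨R, hR⟩ := hpg.exists_le_sylow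
    have := Q.unique_of_normal inferInstance
    rw [Subsingleton.elim R Q] at hR
    exact ⟨⟨x, hx.2⟩, hR (Subgroup.mem_subgroupOf.2 hx.1), rfl⟩
  · refine le_inf ?_ (Subgroup.map_subtype_le _)
    have hpg : IsPGroup p (((Q : Subgroup M).map M.subtype).subgroupOf K) := by
      rintro ⟨y, hy⟩
      obtain ⟨k, hk⟩ := Q.exists_pow_eq_one_of_mem_map_subtype (Subgroup.mem_subgroupOf.1 hy)
      exact ⟨k, Subtype.ext (Subtype.ext hk)⟩
    intro x hx
    exact ⟨⟨x, hMK (Subgroup.map_subtype_le _ hx)⟩,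
      hpg.le_sylow_of_normal P (Subgroup.mem_subgroupOf.2 hx), rfl⟩

theorem normal_of_normal_map_subtype (h : ((P : Subgroup K).map K.subtype).Normal) :
    (P : Subgroup K).Normal := by
  have := h.subgroupOf K
  rwa [Subgroup.subgroupOf, Subgroup.comap_map_eq_self_of_injective K.subtype_injective] at this

end Sylow

theorem Subgroup.isNilpotent_of_forall_normal_map_sylow [Finite G] {K : Subgroup G}
    (h : ∀ (p : ℕ) [Fact p.Prime] (P : Sylow p K), ((P : Subgroup K).map K.subtype).Normal) :
    Group.IsNilpotent K :=
  (Group.isNilpotent_of_finite_tfae.out 0 3 rfl rfl).2 fun p _ P =>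
    P.normal_of_normal_map_subtype (h p P)

namespace FDRep

variable {V : FDRep ℂ G} {N M H : Subgroup G}

theorem eq_bot_or_eq_top_of_sup_eq_top [M.Normal] (hV : Simple V) (hMH : M ⊔ H = ⊤)
    (hM : ∀ m ∈ M, V.ρ m = 1) (S : Submodule ℂ V) (hS : ∀ h ∈ H, ∀ v ∈ S, V.ρ h v ∈ S) :
    S = ⊥ ∨ S = ⊤ := by
  refine V.eq_bot_or_eq_top_of_simple hV S fun g v hv => ?_
  obtain ⟨m, hm, h, hh, rfl⟩ := Subgroup.mem_sup_of_normal_left.1 (hMH ▸ Subgroup.mem_top g)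
  rw [map_mul, hM m hm, one_mul]
  exact hS h hh v hv

theorem maxDegreeOver [Finite G] [M.Normal] (hV : Simple V) (hVN : ∃ n ∈ N, V.ρ n ≠ 1)
    (hmax : ∀ d ∈ cdOver G N, d ≤ Module.finrank ℂ V) (hMN : M ≤ N) (hMH : M ⊔ H = ⊤)
    (hM : ∀ m ∈ M, V.ρ m = 1) : Representation.MaxDegreeOver V.ρ H := by
  intro U _ _ _ σ hσ f hf hequiv
  refine hmax _ ⟨FDRep.of σ, simple_of_isIrreducible σ, fun hN => ?_, rfl⟩
  have hrange : f.range = ⊤ := by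
    refine (eq_bot_or_eq_top_of_sup_eq_top hV hMH hM f.range ?_).resolve_left
      fun h => hf (LinearMap.range_eq_bot.1 h)
    rintro h hh _ ⟨u, rfl⟩
    exact ⟨_, hequiv h hh u⟩
  obtain ⟨n, hn, hne⟩ := hVN
  apply hne
  obtain ⟨m, hm, h, hh, rfl⟩ := Subgroup.mem_sup_of_normal_left.1 (hMH ▸ Subgroup.mem_top n)
  have hhN : h ∈ N := (Subgroup.mul_mem_cancel_left N (hMN hm)).1 hn
  rw [map_mul, hM m hm, one_mul]
  ext v
  obtain ⟨u, rfl⟩ := LinearMap.range_eq_top.1 hrange v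
  have hσh : σ h = 1 := (FDRep.of σ).ρ_eq_one_of_character_eq (hN h hhN)
  rw [← hequiv h hh, hσh]
  rfl

end FDRep

/-- If a Sylow subgroup of the normal subgroup `K` acts trivially, it is normal. -/
theorem Sylow.normal_map_subtype_of_maxDegreeOver [Fintype G] {V : Type} [AddCommGroup V]
    [Module ℂ V] [FiniteDimensional ℂ V] [Nontrivial V] {ρ : Representation ℂ G V} {p : ℕ}
    {K : Subgroup G} [K.Normal] (P : Sylow p K) {H : Subgroup G}
    (hH : H = Subgroup.normalizer ((P : Subgroup K).map K.subtype : Set G))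
    (hirr : ∀ S : Submodule ℂ V, (∀ h ∈ H, ∀ v ∈ S, ρ h v ∈ S) → S = ⊥ ∨ S = ⊤)
    (hmax : ρ.MaxDegreeOver H) (htriv : ∀ x ∈ (P : Subgroup K).map K.subtype, ρ x = 1) :
    ((P : Subgroup K).map K.subtype).Normal := by
  classical
  have hle : (P : Subgroup K).map K.subtype ≤ H.normalCore := by
    intro x hx
    by_contra hxc
    have hxH : x ∈ H := hH ▸ Subgroup.le_normalizer hx
    have h := Representation.sum_smul_normalCore_eq_zero hirr hmax
      (a := Pi.single x 1 - Pi.single 1 1) (fun y hy => ?_) ?_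
    · have h1 : ∀ y : G, (if y ∈ H.normalCore then (Pi.single x 1 - Pi.single 1 1 : G → ℂ) y else 0)
          = - Pi.single (M := fun _ => ℂ) 1 1 y := by
        intro y
        by_cases hy : y ∈ H.normalCore
        · have : y ≠ x := fun h => hxc (h ▸ hy)
          simp [hy, this]
        · have : y ≠ 1 := fun h => hy (h ▸ one_mem _)
          simp [hy, this]
      simp only [h1, neg_smul, Finset.sum_neg_distrib, Pi.single_apply, ite_smul, zero_smul,
        one_smul, Finset.sum_ite_eq', Finset.mem_univ, if_true, map_one] at h
      exact one_ne_zero (neg_eq_zero.1 h)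
    · have h1 : y ≠ x := fun h => hy (h ▸ hxH)
      have h2 : y ≠ 1 := fun h => hy (h ▸ one_mem _)
      simp [h1, h2]
    · simp [sub_smul, Finset.sum_sub_distrib, Pi.single_apply, ite_smul, htriv x hx]
  subst hH
  have := P.normal_map_subtype_inf_normalCore
  rwa [inf_eq_left.2 hle] at this

theorem FDRep.exists_fixed_of_sum_ne_zero [Fintype G] (V : FDRep ℂ G) (Q : Subgroup G)
    [DecidablePred (· ∈ Q)] (hsum : ∑ x, (if x ∈ Q then (1 : ℂ) else 0) • V.ρ x ≠ 0) :
    ∃ v : V, v ≠ 0 ∧ ∀ y ∈ Q, V.ρ y v = v := by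
  set T : Module.End ℂ V := ∑ x, (if x ∈ Q then (1 : ℂ) else 0) • V.ρ x with hT
  obtain ⟨w, hw⟩ : ∃ w, T w ≠ 0 := by
    by_contra! h
    exact hsum (LinearMap.ext h)
  refine ⟨T w, hw, fun y hy => ?_⟩
  have h : V.ρ y * T = T := by
    rw [hT, Finset.mul_sum]
    refine Fintype.sum_equiv (Equiv.mulLeft y) _ _ fun x => ?_
    simp [Subgroup.mul_mem_cancel_left Q hy]
  exact LinearMap.congr_fun h w

theorem FDRep.eq_one_of_fixed {V : FDRep ℂ G} (hV : Simple V) {K : Subgroup G} [K.Normal]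
    {v : V} (hv : v ≠ 0) (hfix : ∀ k ∈ K, V.ρ k v = v) : ∀ k ∈ K, V.ρ k = 1 := by
  let S : Submodule ℂ V := ⨅ k : K, LinearMap.eqLocus (V.ρ k) 1
  have hmem : ∀ w, w ∈ S ↔ ∀ k ∈ K, V.ρ k w = w := by simp [S]
  have hS := (V.eq_bot_or_eq_top_of_simple hV S fun g w hw => (hmem _).2 fun k hk => ?_).resolve_left
    fun h => hv ((Submodule.mem_bot ℂ).1 (h ▸ (hmem v).2 hfix))
  · intro k hk
    ext w
    exact (hmem w).1 (hS ▸ Submodule.mem_top) k hk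
  · have h1 := (hmem w).1 hw (g⁻¹ * k * g) (by
      simpa using Subgroup.Normal.conj_mem (H := K) inferInstance k hk g⁻¹)
    rw [← Module.End.mul_apply, ← map_mul, show k * g = g * (g⁻¹ * k * g) by group, map_mul,
      Module.End.mul_apply, h1]

theorem Sylow.map_subtype_sup_normal [Finite G] {p : ℕ} [Fact p.Prime] {M K : Subgroup G}
    [M.Normal] [K.Normal] (hMK : M ≤ K) (hab : ⁅K, K⁆ ≤ M) (P : Sylow p K) :
    (M ⊔ (P : Subgroup K).map K.subtype).Normal := by
  set P' := (P : Subgroup K).map K.subtype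
  rw [← Subgroup.normalizer_eq_top_iff, eq_top_iff, ← P.normalizer_sup_eq_top]
  refine sup_le ?_ ?_
  · exact (Subgroup.normalizer_le_normalizer_sup_normal (H := P') (K := M)).trans_eq
      (by rw [sup_comm])
  · have hconj : ∀ k ∈ K, ∀ x ∈ M ⊔ P', k * x * k⁻¹ ∈ M ⊔ P' := fun k hk x hx => by
      have hxK : x ∈ K := sup_le hMK (Subgroup.map_subtype_le _) hx
      have h := Subgroup.mul_mem _ (le_sup_left (b := P') (hab
        (Subgroup.commutator_mem_commutator hk hxK))) hx
      simpa [commutatorElement_def] using h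
    intro k hk
    rw [Subgroup.mem_normalizer_iff]
    refine fun x => ⟨hconj k hk x, fun hx => ?_⟩
    simpa [mul_assoc] using hconj k⁻¹ (K.inv_mem hk) _ hx

/-- **Theorem 4.1.** Let `N ⊴ G` be nontrivial and `χ ∈ Irr(G|N)` with
`χ(1) = max cd(G|N)` (the character `χ` is formalized by a simple `V : FDRep ℂ G` with
`N ⊄ ker χ`, and maximality of its degree is the hypothesis `hmax`).  Then
`N ∩ ker χ` (where `ker χ = {g : χ(g) = χ(1)}`, which is indeed a subgroup) is nilpotent.
Moreover, for every abelian chief factor `K/M` of `G` with `M ⊆ N ∩ ker χ`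
(a chief factor is formalized as `M < K`, both normal in `G`, with no normal subgroup of
`G` strictly between them; abelian means `⁅K,K⁆ ≤ M`), the subgroup `K` is nilpotent. -/
theorem stmt4 (G : Type) [Group G] [Fintype G] (N : Subgroup G) [N.Normal] (hN : N ≠ ⊥)
    (V : FDRep ℂ G) (hV : Simple V)
    (hVN : ¬ ∀ n ∈ N, V.character n = V.character 1)
    (hmax : ∀ d ∈ cdOver G N, d ≤ Module.finrank ℂ V) :
    (∃ K₀ : Subgroup G, (K₀ : Set G) = {g | g ∈ N ∧ V.character g = V.character 1} ∧
        Group.IsNilpotent ↥K₀) ∧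
    ∀ M K : Subgroup G, M.Normal → K.Normal → M < K →
      (∀ L : Subgroup G, L.Normal → M ≤ L → L ≤ K → L = M ∨ L = K) →
      ⁅K, K⁆ ≤ M →
      M ≤ N → (∀ m ∈ M, V.character m = V.character 1) →
      Group.IsNilpotent ↥K := by
  classical
  have hker : ∀ g, V.ρ g = 1 ↔ V.character g = V.character 1 := fun g =>
    ⟨fun h => by simp only [FDRep.character, h, map_one], V.ρ_eq_one_of_character_eq⟩
  have hVN' : ∃ n ∈ N, V.ρ n ≠ 1 := by
    push Not at hVN
    obtain ⟨n, hn, h⟩ := hVN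
    exact ⟨n, hn, fun h' => h ((hker n).1 h')⟩
  have hnt : Nontrivial V := by
    obtain ⟨n, _, h⟩ := hVN'
    by_contra hs
    rw [not_nontrivial_iff_subsingleton] at hs
    exact h (LinearMap.ext fun v => Subsingleton.elim _ _)
  have hK₀ : Group.IsNilpotent ↥(N ⊓ V.ρ.ker) := by
    refine Subgroup.isNilpotent_of_forall_normal_map_sylow fun p _ P => ?_
    have htop := (sup_comm _ _).trans P.normalizer_sup_eq_top
    have htriv : ∀ m ∈ N ⊓ V.ρ.ker, V.ρ m = 1 := fun m hm => hm.2
    exact P.normal_map_subtype_of_maxDegreeOver rfl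
      (FDRep.eq_bot_or_eq_top_of_sup_eq_top hV htop htriv)
      (FDRep.maxDegreeOver hV hVN' hmax inf_le_left htop htriv)
      fun x hx => htriv x (Subgroup.map_subtype_le _ hx)
  refine ⟨⟨N ⊓ V.ρ.ker, Set.ext fun g => and_congr Iff.rfl (hker g), hK₀⟩, ?_⟩
  intro M K hMn hKn hlt hchief hab hMN hMχ
  have hM : ∀ m ∈ M, V.ρ m = 1 := fun m hm => (hker m).2 (hMχ m hm)
  have hMnil : Group.IsNilpotent M :=
    Group.nilpotent_of_mulEquiv (Subgroup.subgroupOfEquivOfLe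
      (show M ≤ N ⊓ V.ρ.ker from fun m hm => ⟨hMN hm, hM m hm⟩))
  refine Subgroup.isNilpotent_of_forall_normal_map_sylow fun p _ P => ?_
  set P' := (P : Subgroup K).map K.subtype
  have hP'K : P' ≤ K := Subgroup.map_subtype_le _
  have hPM : (P' ⊓ M).Normal := P.normal_map_subtype_inf_of_isNilpotent hlt.le
  have hPC : (P' ⊓ (Subgroup.normalizer (P' : Set G)).normalCore).Normal :=
    P.normal_map_subtype_inf_normalCore
  set P₀ := P' ⊓ (Subgroup.normalizer (P' : Set G)).normalCore
  have hMP := Sylow.map_subtype_sup_normal hlt.le hab P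
  rcases hchief (M ⊔ P') hMP le_sup_left (sup_le hlt.le hP'K) with h | hKMP
  · rwa [inf_eq_left.2 (sup_eq_left.1 h)] at hPM
  rcases hchief (M ⊔ P₀) inferInstance le_sup_left (sup_le hlt.le (inf_le_left.trans hP'K)) with
    h | hKMP₀
  · have hP₀M : P₀ ≤ M := sup_eq_left.1 h
    have htop : M ⊔ Subgroup.normalizer (P' : Set G) = ⊤ := by
      rw [eq_top_iff, ← P.normalizer_sup_eq_top]
      exact sup_le le_sup_right (hKMP.ge.trans
        (sup_le le_sup_left (Subgroup.le_normalizer.trans le_sup_right)))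
    have hirr := FDRep.eq_bot_or_eq_top_of_sup_eq_top hV htop hM
    have hdeg := FDRep.maxDegreeOver hV hVN' hmax hMN htop hM
    have hsum : ∑ x, (if x ∈ P' then (1 : ℂ) else 0) • V.ρ x ≠ 0 := by
      intro h0
      have h1 := Representation.sum_smul_normalCore_eq_zero hirr hdeg
        (fun x hx => if_neg fun h => hx (Subgroup.le_normalizer h)) h0
      have h2 : ∑ x, (if x ∈ P₀ then (1 : ℂ) else 0) • (1 : Module.End ℂ V) = 0 := by
        rw [← h1]
        refine Finset.sum_congr rfl fun x _ => ?_
        rw [← ite_and]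
        by_cases hx : x ∈ P₀
        · rw [if_pos hx, if_pos ⟨hx.2, hx.1⟩, hM x (hP₀M hx)]
        · rw [if_neg hx, if_neg fun h => hx ⟨h.2, h.1⟩, zero_smul, zero_smul]
      rw [← Finset.sum_smul, Finset.sum_boole, smul_eq_zero, Nat.cast_eq_zero,
        Finset.card_eq_zero] at h2
      have h3 := h2.resolve_right one_ne_zero
      exact Finset.notMem_empty (1 : G) (h3 ▸ by simp)
    obtain ⟨v, hv0, hv⟩ := V.exists_fixed_of_sum_ne_zero P' hsum
    have hK : ∀ k ∈ K, V.ρ k = 1 := by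
      refine FDRep.eq_one_of_fixed hV hv0 fun k hk => ?_
      obtain ⟨m, hm, x, hx, rfl⟩ := Subgroup.mem_sup_of_normal_left.1 (hKMP.ge hk)
      rw [map_mul, hM m hm, one_mul, hv x hx]
    exact P.normal_map_subtype_of_maxDegreeOver rfl hirr hdeg fun x hx => hK x (hP'K hx)
  · have hP'eq : P' = (P' ⊓ M) ⊔ P₀ := by
      refine le_antisymm (fun x hx => ?_) (sup_le inf_le_left inf_le_left)
      obtain ⟨m, hm, y, hy, rfl⟩ := Subgroup.mem_sup_of_normal_left.1 (hKMP₀.ge (hP'K hx))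
      exact Subgroup.mul_mem_sup ⟨(Subgroup.mul_mem_cancel_right P' hy.1).1 hx, hm⟩ hy
    rw [hP'eq]
    infer_instance
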